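/- Let F be a field of characteristic not equal to 2, let a ∈ F× \ F×², let K = F(√a) be the quadratic extension obtained by adjoining a square root of a, and let N : K× → F× be the field norm. Then F×·R(K) ⊆ N⁻¹(R(F)); that is, for every x ∈ R(K) and every c ∈ F×, the norm N(c·x) lies in R(F). (This is the unconditional inclusion in the Hilbert 90 theorem for the Kaplansky radical.) -/

import Mathlib

/-- The Kaplansky radical `R(L)`. -/
def KRad (L : Type*) [Field L] : Set L :=
  {a : L | a ≠ 0 ∧ ∀ b : L, b ≠ 0 → ∃ u v : L, b = u ^ 2 - a * v ^ 2}

/-- The relation "`x` is represented by `⟨1, -b⟩`" is symmetric in nonzero `x` and `b`. -/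
theorem exists_eq_sq_sub_mul_sq_symm {L : Type*} [Field L] (h2 : (2 : L) ≠ 0) {x b : L}
    (hx : x ≠ 0) (h : ∃ p q : L, x = p ^ 2 - b * q ^ 2) :
    ∃ u v : L, b = u ^ 2 - x * v ^ 2 := by
  obtain ⟨p, q, h⟩ := h
  by_cases hq : q = 0
  · subst hq
    have hp : p ≠ 0 := by
      rintro rfl
      exact hx (by simpa using h)
    refine ⟨(b + 1) / 2, (b - 1) / (2 * p), ?_⟩
    rw [h]
    field_simp
    ring
  · refine ⟨p / q, 1 / q, ?_⟩
    rw [h]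
    field_simp
    ring

/-- Let `F` be a field of characteristic `≠ 2`, `a ∈ F× \ F×²`, and
`K = F(√a)` the quadratic extension obtained by adjoining a square root `α` of `a`
(so every element of `K` is `u + w·α` with `u, w ∈ F`).  The norm map
`N : K× → F×` is given by `N(u + w·α) = u² − a·w²`.  Then `F×·R(K) ⊆ N⁻¹(R(F))`:
for every `x = u + w·α ∈ R(K)` and every `c ∈ F×`, the norm
`N(c·x) = c²·(u² − a·w²)` lies in `R(F)`. -/
theorem norm_of_radical_in_radical
    {F K : Type*} [Field F] [Field K] [Algebra F K]
    (hchar : ringChar F ≠ 2)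
    (a : F) (ha : a ≠ 0) (hns : ¬∃ c : F, a = c ^ 2)
    (α : K) (hα : α ^ 2 = algebraMap F K a)
    (hgen : ∀ z : K, ∃ u w : F, z = algebraMap F K u + algebraMap F K w * α) :
    ∀ u w : F, (algebraMap F K u + algebraMap F K w * α) ∈ KRad K →
      ∀ c : F, c ≠ 0 → c ^ 2 * (u ^ 2 - a * w ^ 2) ∈ KRad F := by
  intro u w hx c hc
  obtain ⟨hx0, hx⟩ := hx
  have h2 : (2 : F) ≠ 0 := Ring.two_ne_zero hchar
  have h2K : (2 : K) ≠ 0 := by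
    rw [← map_ofNat (algebraMap F K) 2]
    exact (map_ne_zero (algebraMap F K)).2 h2
  have hindep : ∀ s t : F, algebraMap F K s + algebraMap F K t * α = 0 → s = 0 ∧ t = 0 := by
    intro s t hst
    have hsq : s ^ 2 = a * t ^ 2 := by
      apply (algebraMap F K).injective
      simp only [map_mul, map_pow, ← hα]
      linear_combination (algebraMap F K s - algebraMap F K t * α) * hst
    have ht : t = 0 := by
      by_contra ht
      refine hns ⟨s / t, ?_⟩
      field_simp
      exact hsq.symm
    subst ht
    exact ⟨by simpa using hsq, rfl⟩
  have hN : u ^ 2 - a * w ^ 2 ≠ 0 := by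
    intro h
    have hw : w = 0 := by
      by_contra hw
      refine hns ⟨u / w, ?_⟩
      field_simp
      linear_combination -h
    subst hw
    have hu : u = 0 := by simpa using h
    subst hu
    exact hx0 (by simp)
  have hcN : c ^ 2 * (u ^ 2 - a * w ^ 2) ≠ 0 := mul_ne_zero (pow_ne_zero 2 hc) hN
  refine ⟨hcN, fun b hb => exists_eq_sq_sub_mul_sq_symm h2 hcN ?_⟩
  have hbK : algebraMap F K b ≠ 0 := (map_ne_zero _).2 hb
  obtain ⟨p, q, hpq⟩ := exists_eq_sq_sub_mul_sq_symm h2K hbK (hx _ hbK)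
  obtain ⟨p₁, p₂, rfl⟩ := hgen p
  obtain ⟨q₁, q₂, rfl⟩ := hgen q
  obtain ⟨hu, hw⟩ := hindep (u - (p₁ ^ 2 + a * p₂ ^ 2 - b * (q₁ ^ 2 + a * q₂ ^ 2)))
    (w - (2 * p₁ * p₂ - 2 * b * q₁ * q₂)) (by
      simp only [map_sub, map_add, map_mul, map_pow, map_ofNat, ← hα]
      linear_combination hpq)
  rw [sub_eq_zero] at hu hw
  refine ⟨c * (p₁ ^ 2 + b * q₁ ^ 2 - a * p₂ ^ 2 - a * b * q₂ ^ 2),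
    c * (2 * (p₁ * q₁ - a * p₂ * q₂)), ?_⟩
  rw [hu, hw]
  ring
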